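/- For every n ≥ 1 and m ≥ 0, there is a bijection T : SP⁺(n,m+1) → SP⁰(n,m), i.e., the set of Schröder paths of semilength n with n−m−1 diagonal steps having no diagonal step on the diagonal is in bijection with the set of Schröder paths of semilength n with n−m diagonal steps having at least one diagonal step on the diagonal. -/

import Mathlib

/-! Schröder paths -/

inductive SStep : Type
  | H | V | D
deriving DecidableEq

def SStep.dx : SStep → ℕ
  | .H => 1 | .V => 0 | .D => 1

def SStep.dy : SStep → ℕ
  | .H => 0 | .V => 1 | .D => 1

def pathX (p : List SStep) : ℕ := (p.map SStep.dx).sum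
def pathY (p : List SStep) : ℕ := (p.map SStep.dy).sum

/-- A Schröder path of semilength `n`: from (0,0) to (n,n), steps H,V,D,
never rising above the diagonal. -/
def IsSchroder (n : ℕ) (p : List SStep) : Prop :=
  pathX p = n ∧ pathY p = n ∧ ∀ q : List SStep, q <+: p → pathY q ≤ pathX q

/-- No diagonal step starts on the diagonal. -/
def DiagFree (p : List SStep) : Prop :=
  ∀ q r : List SStep, p = q ++ SStep.D :: r → pathX q ≠ pathY q

/-- Every diagonal step is immediately followed by a horizontal step,
except if it is the last step. -/
def DFollowedByH (p : List SStep) : Prop :=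
  ∀ q r : List SStep, p = q ++ SStep.D :: r → r = [] ∨ ∃ r' : List SStep, r = SStep.H :: r'

def SP (n m : ℕ) : Type := {p : List SStep // IsSchroder n p ∧ p.count SStep.D + m = n}
def SPplus (n m : ℕ) : Type :=
  {p : List SStep // IsSchroder n p ∧ p.count SStep.D + m = n ∧ DiagFree p}
def SPzero (n m : ℕ) : Type :=
  {p : List SStep // IsSchroder n p ∧ p.count SStep.D + m = n ∧ ¬ DiagFree p}
def RP (n m : ℕ) : Type :=
  {p : List SStep // IsSchroder n p ∧ p.count SStep.D + m = n ∧ DFollowedByH p}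

/-! Rooted planar trees -/

inductive PTree : Type
  | node : List PTree → PTree

namespace PTree

def leaves : PTree → ℕ
  | node [] => 1
  | node (c :: cs) => ((c :: cs).attach.map fun x => leaves x.1).sum
decreasing_by
  have := List.sizeOf_lt_of_mem x.2
  simp only [PTree.node.sizeOf_spec, List.cons.sizeOf_spec] at this ⊢
  omega

def internal : PTree → ℕ
  | node [] => 0
  | node (c :: cs) => 1 + ((c :: cs).attach.map fun x => internal x.1).sum
decreasing_by
  have := List.sizeOf_lt_of_mem x.2
  simp only [PTree.node.sizeOf_spec, List.cons.sizeOf_spec] at this ⊢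
  omega

def Good : PTree → Prop
  | node cs => cs.length ≠ 1 ∧ ∀ c ∈ cs.attach, Good c.1
decreasing_by
  have := List.sizeOf_lt_of_mem c.2
  simp only [PTree.node.sizeOf_spec] at this ⊢
  omega

end PTree

def PT (n m : ℕ) : Type :=
  {t : PTree // t.Good ∧ t.leaves = n + 1 ∧ t.internal = m}

def PTn (n : ℕ) : Type := {t : PTree // t.Good ∧ t.leaves = n + 1}

/-! Motzkin paths -/

inductive MStep : Type
  | U | H | D
deriving DecidableEq

def MStep.dh : MStep → ℤ
  | .U => 1 | .H => 0 | .D => -1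

def mHeight (p : List MStep) : ℤ := (p.map MStep.dh).sum

def IsMotzkin (k : ℕ) (p : List MStep) : Prop :=
  p.length = k ∧ mHeight p = 0 ∧ ∀ q : List MStep, q <+: p → 0 ≤ mHeight q

def HFollowedByU (p : List MStep) : Prop :=
  ∀ q r : List MStep, p = q ++ MStep.H :: r → r = [] ∨ ∃ r' : List MStep, r = MStep.U :: r'

def MP (k : ℕ) : Type := {p : List MStep // IsMotzkin k p}
def RMP (k : ℕ) : Type := {p : List MStep // IsMotzkin k p ∧ HFollowedByU p}

/-- Motzkin steps with two possible colors on up and horizontal steps. -/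
inductive CMStep : Type
  | U : Bool → CMStep
  | H : Bool → CMStep
  | D : CMStep
deriving DecidableEq

def CMStep.forget : CMStep → MStep
  | .U _ => .U | .H _ => .H | .D => .D

/-- (h,u)-colored Motzkin paths of length n-1. -/
def huMP (n : ℕ) : Type := {p : List CMStep // IsMotzkin (n - 1) (p.map CMStep.forget)}

/-- The path never rises above the diagonal when it starts `k` units to the right of it. -/
def StaysBelow (k : ℕ) (p : List SStep) : Prop :=
  ∀ q : List SStep, q <+: p → pathY q ≤ pathX q + k

@[simp] theorem pathX_nil : pathX [] = 0 := rfl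

@[simp] theorem pathY_nil : pathY [] = 0 := rfl

@[simp] theorem pathX_cons (s : SStep) (p : List SStep) : pathX (s :: p) = s.dx + pathX p := by
  simp [pathX]

@[simp] theorem pathY_cons (s : SStep) (p : List SStep) : pathY (s :: p) = s.dy + pathY p := by
  simp [pathY]

@[simp] theorem pathX_append (p q : List SStep) : pathX (p ++ q) = pathX p + pathX q := by
  simp [pathX]

@[simp] theorem pathY_append (p q : List SStep) : pathY (p ++ q) = pathY p + pathY q := by
  simp [pathY]

theorem staysBelow_nil (k : ℕ) : StaysBelow k [] := by
  intro q hq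
  simp [List.prefix_nil.mp hq]

theorem StaysBelow.cons {k l : ℕ} {s : SStep} {p : List SStep} (hp : StaysBelow l p)
    (h : l + s.dy ≤ k + s.dx) : StaysBelow k (s :: p) := by
  intro q hq
  rcases List.prefix_cons_iff.mp hq with rfl | ⟨t, rfl, ht⟩
  · simp
  · have := hp t ht
    simp only [pathX_cons, pathY_cons]
    omega

theorem StaysBelow.append {k l : ℕ} {p q : List SStep} (hp : StaysBelow k p)
    (hq : StaysBelow l q) (h : pathY p + l ≤ pathX p + k) : StaysBelow k (p ++ q) := by
  rintro r ⟨t, ht⟩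
  rcases List.append_eq_append_iff.mp ht with ⟨c, hc, -⟩ | ⟨c, rfl, hc⟩
  · exact hp r ⟨c, hc.symm⟩
  · have := hq c ⟨t, hc.symm⟩
    simp only [pathX_append, pathY_append]
    omega

theorem StaysBelow.left {k : ℕ} {p q : List SStep} (h : StaysBelow k (p ++ q)) :
    StaysBelow k p :=
  fun r hr => h r (hr.trans (List.prefix_append p q))

theorem StaysBelow.right {k l : ℕ} {p q : List SStep} (h : StaysBelow k (p ++ q))
    (hl : pathX p + k ≤ pathY p + l) : StaysBelow l q := by
  intro r hr
  have := h (p ++ r) ((List.prefix_append_right_inj p).mpr hr)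
  simp only [pathX_append, pathY_append] at this
  omega

/-- First passage decomposition: a path ending strictly above level `k` has a first vertical
step leaving that level. -/
theorem exists_first_passage (p : List SStep) (k : ℕ) (h : pathX p + k < pathY p) :
    ∃ a b, p = a ++ SStep.V :: b ∧ pathX a + k = pathY a ∧ StaysBelow k a := by
  induction p generalizing k with
  | nil => simp at h
  | cons s p ih =>
    have key (l : ℕ) (h₁ : pathX p + l < pathY p) (h₂ : l + s.dy = k + s.dx) :
        ∃ a b, s :: p = a ++ SStep.V :: b ∧ pathX a + k = pathY a ∧ StaysBelow k a := by
      obtain ⟨a, b, rfl, hab, ha⟩ := ih l h₁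
      refine ⟨s :: a, b, rfl, ?_, ha.cons h₂.le⟩
      simp only [pathX_cons, pathY_cons]
      omega
    cases s with
    | H => exact key (k + 1) (by simp [SStep.dx, SStep.dy] at h; omega) rfl
    | D => exact key k (by simp [SStep.dx, SStep.dy] at h; omega) rfl
    | V =>
      cases k with
      | zero => exact ⟨[], p, rfl, rfl, staysBelow_nil 0⟩
      | succ k => exact key k (by simp [SStep.dx, SStep.dy] at h; omega) rfl

theorem DiagFree.right {p q : List SStep} (h : DiagFree (p ++ q)) (hp : pathX p = pathY p) :
    DiagFree q := by
  rintro c r rfl hc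
  exact h (p ++ c) r (by simp) (by simp [hp, hc])

/-- Decomposition of a path at its last diagonal step lying on the diagonal. -/
theorem exists_last_diagonal (p : List SStep) (h : ¬ DiagFree p) :
    ∃ a b, p = a ++ SStep.D :: b ∧ pathX a = pathY a ∧ DiagFree b := by
  have h' := h
  simp only [DiagFree, not_forall, not_not] at h'
  obtain ⟨q, r, hp, hq⟩ := h'
  by_cases hr : DiagFree r
  · exact ⟨q, r, hp, hq, hr⟩
  · obtain ⟨a, b, hab, ha, hb⟩ := exists_last_diagonal r hr
    refine ⟨q ++ SStep.D :: a, b, by simp [hp, hab], ?_, hb⟩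
    simp [hq, ha, SStep.dx, SStep.dy]
termination_by p.length
decreasing_by
  subst hp
  simp
  omega

theorem diagFree_lift {a b : List SStep} (ha : StaysBelow 0 a) (hab : pathX a = pathY a)
    (hb : DiagFree b) : DiagFree (SStep.H :: (a ++ SStep.V :: b)) := by
  intro q r h hq
  cases q with
  | nil => simp at h
  | cons s q =>
    simp only [List.cons_append, List.cons.injEq] at h
    obtain ⟨rfl, h⟩ := h
    simp only [pathX_cons, pathY_cons, SStep.dx, SStep.dy] at hq
    rcases List.append_eq_append_iff.mp h with ⟨c, rfl, hc⟩ | ⟨c, rfl, -⟩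
    · cases c with
      | nil => simp at hc
      | cons s c =>
        simp only [List.cons_append, List.cons.injEq] at hc
        obtain ⟨rfl, hc⟩ := hc
        refine hb c r hc ?_
        simp only [pathX_append, pathY_append, pathX_cons, pathY_cons, SStep.dx, SStep.dy] at hq
        omega
    · have := ha q (List.prefix_append q c)
      omega

theorem first_passage_unique {a b a' b' : List SStep} (ha : pathX a = pathY a)
    (ha' : StaysBelow 0 a')
    (h : a ++ SStep.V :: b = a' ++ SStep.V :: b') : a'.length ≤ a.length := by
  rcases List.append_eq_append_iff.mp h with ⟨c, rfl, hc⟩ | ⟨c, rfl, -⟩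
  · cases c with
    | nil => simp
    | cons s c =>
      simp only [List.cons_append, List.cons.injEq] at hc
      obtain ⟨rfl, -⟩ := hc
      have := ha' (a ++ [SStep.V]) ⟨c, by simp⟩
      simp [SStep.dx, SStep.dy] at this
      omega
  · simp

theorem last_diagonal_unique {a b a' b' : List SStep} (ha : pathX a = pathY a)
    (ha' : pathX a' = pathY a') (hb : DiagFree b)
    (h : a ++ SStep.D :: b = a' ++ SStep.D :: b') : a'.length ≤ a.length := by
  rcases List.append_eq_append_iff.mp h with ⟨c, rfl, hc⟩ | ⟨c, rfl, -⟩
  · cases c with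
    | nil => simp
    | cons s c =>
      simp only [List.cons_append, List.cons.injEq] at hc
      obtain ⟨rfl, hc⟩ := hc
      refine absurd ?_ (hb c b' hc)
      simp [SStep.dx, SStep.dy] at ha'
      omega
  · simp

/-- Pairs of Schröder paths, the second without diagonal steps on the diagonal, of total
semilength `n - 1` and with `n - m - 1` diagonal steps in total. -/
def SchroderPair (n m : ℕ) : Type :=
  {w : List SStep × List SStep // pathX w.1 = pathY w.1 ∧ StaysBelow 0 w.1 ∧
    pathX w.2 = pathY w.2 ∧ StaysBelow 0 w.2 ∧ DiagFree w.2 ∧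
    pathX w.1 + pathX w.2 + 1 = n ∧ w.1.count SStep.D + w.2.count SStep.D + (m + 1) = n}

namespace SchroderPair

/-- The path `H a V b` associated with the pair `(a, b)`. -/
def toPlus {n m : ℕ} (w : SchroderPair n m) : SPplus n (m + 1) :=
  ⟨SStep.H :: (w.1.1 ++ SStep.V :: w.1.2), by
    obtain ⟨⟨a, b⟩, hab, ha, hbb, hb, hf, hn, hm⟩ := w
    dsimp only at hab ha hbb hb hf hn hm ⊢
    refine ⟨⟨?_, ?_, ?_⟩, ?_, diagFree_lift ha hab hf⟩
    · simp [SStep.dx]; omega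
    · simp [SStep.dy]; omega
    · refine StaysBelow.cons (k := 0) (l := 1) (StaysBelow.append (l := 1) ?_ ?_ ?_) (by rfl)
      · exact fun q hq => (ha q hq).trans (by omega)
      · exact hb.cons (by rfl)
      · omega
    · simpa using hm⟩

/-- The path `a D b` associated with the pair `(a, b)`. -/
def toZero {n m : ℕ} (w : SchroderPair n m) : SPzero n m :=
  ⟨w.1.1 ++ SStep.D :: w.1.2, by
    obtain ⟨⟨a, b⟩, hab, ha, hbb, hb, hf, hn, hm⟩ := w
    dsimp only at hab ha hbb hb hf hn hm ⊢
    refine ⟨⟨?_, ?_, ?_⟩, ?_, fun h => h a b rfl hab⟩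
    · simp [SStep.dx]; omega
    · simp [SStep.dy]; omega
    · exact ha.append (l := 0) (hb.cons (by rfl)) (by omega)
    · simp; omega⟩

theorem toPlus_bijective {n m : ℕ} (hn : 1 ≤ n) :
    Function.Bijective (toPlus : SchroderPair n m → SPplus n (m + 1)) := by
  constructor
  · rintro ⟨⟨a, b⟩, hab, ha, _⟩ ⟨⟨a', b'⟩, hab', ha', _⟩ h
    have h' : a ++ SStep.V :: b = a' ++ SStep.V :: b' :=
      List.tail_eq_of_cons_eq (congrArg Subtype.val h)
    obtain ⟨rfl, hb⟩ := List.append_inj h' <|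
      (first_passage_unique hab' ha h'.symm).antisymm (first_passage_unique hab ha' h')
    obtain rfl := List.tail_eq_of_cons_eq hb
    rfl
  · rintro ⟨p, ⟨hx, hy, hp⟩, hm, hf⟩
    replace hp : StaysBelow 0 p := hp
    cases p with
    | nil => simp at hx; omega
    | cons s p =>
      cases s with
      | D => exact absurd rfl (hf [] p rfl)
      | V =>
        have := hp [SStep.V] ⟨p, rfl⟩
        simp [SStep.dx, SStep.dy] at this
      | H =>
        obtain ⟨a, b, rfl, hab, ha⟩ := exists_first_passage p 0 (by
          simp [SStep.dx, SStep.dy] at hx hy; omega)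
        have hH : SStep.H :: (a ++ SStep.V :: b) = (SStep.H :: (a ++ [SStep.V])) ++ b := by simp
        have hbal : pathX (SStep.H :: (a ++ [SStep.V])) = pathY (SStep.H :: (a ++ [SStep.V])) := by
          simp [SStep.dx, SStep.dy]; omega
        refine ⟨⟨(a, b), hab, ha, ?_, ?_, ?_, ?_, ?_⟩, rfl⟩
        · simp [SStep.dx, SStep.dy] at hx hy ⊢; omega
        · rw [hH] at hp
          exact hp.right (by omega)
        · rw [hH] at hf
          exact hf.right hbal
        · simp [SStep.dx] at hx ⊢; omega
        · simpa using hm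

theorem toZero_bijective {n m : ℕ} :
    Function.Bijective (toZero : SchroderPair n m → SPzero n m) := by
  constructor
  · rintro ⟨⟨a, b⟩, hab, _, _, _, hf, _⟩ ⟨⟨a', b'⟩, hab', _, _, _, hf', _⟩ h
    have h' : a ++ SStep.D :: b = a' ++ SStep.D :: b' := congrArg Subtype.val h
    obtain ⟨rfl, hb⟩ := List.append_inj h' <|
      (last_diagonal_unique hab' hab hf' h'.symm).antisymm (last_diagonal_unique hab hab' hf h')
    obtain rfl := List.tail_eq_of_cons_eq hb
    rfl
  · rintro ⟨p, ⟨hx, hy, hp⟩, hm, hf⟩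
    replace hp : StaysBelow 0 p := hp
    obtain ⟨a, b, rfl, hab, hb⟩ := exists_last_diagonal p hf
    refine ⟨⟨(a, b), hab, hp.left, ?_, ?_, hb, ?_, ?_⟩, rfl⟩
    · simp [SStep.dx, SStep.dy] at hx hy ⊢; omega
    · rw [List.append_cons] at hp
      exact hp.right (by simp [SStep.dx, SStep.dy]; omega)
    · simp [SStep.dx] at hx ⊢; omega
    · simp at hm ⊢; omega

end SchroderPair

/-- a bijection T : SP⁺(n,m+1) → SP⁰(n,m). -/
theorem statement1 (n m : ℕ) (hn : 1 ≤ n) : Nonempty (SPplus n (m + 1) ≃ SPzero n m) :=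
  ⟨(Equiv.ofBijective _ (SchroderPair.toPlus_bijective hn)).symm.trans
    (Equiv.ofBijective _ SchroderPair.toZero_bijective)⟩
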